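/- There exist constants A, c > 0 and σ₀ > 0 such that for all 0 < σ < σ₀, with T = ⌈A·σ^{−c}⌉: sup over x ∈ (−σ^{−9}, 0) of ‖K̂_σ^T(x,·) − π_σ|_{(−∞,0)}‖_TV ≤ σ²·Φ_σ, where π_σ|_{(−∞,0)} is the probability measure on (−∞,0) with density 2f_σ. (In particular, the rapid-mixing-within-the-mode condition of the metastability assumptions holds for the half-line mode of the random-walk Metropolis chain, with polynomially many steps and accuracy σ² times the conductance.) -/

import Mathlib

open MeasureTheory Filter Set

/-- Gaussian density `φ_σ` with mean 0 and variance `σ²`. -/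
noncomputable def gaussDensity (σ x : ℝ) : ℝ :=
  (Real.sqrt (2 * Real.pi * σ ^ 2))⁻¹ * Real.exp (-(x ^ 2) / (2 * σ ^ 2))

/-- Density `f_σ` of the mixture `½ N(-1,σ²) + ½ N(1,σ²)`. -/
noncomputable def mixDensity (σ x : ℝ) : ℝ :=
  (1 / 2) * gaussDensity σ (x + 1) + (1 / 2) * gaussDensity σ (x - 1)

/-- The random-walk Metropolis transition probability `K_σ(x, A)` (real-valued form):
`K_σ(x,A) = ∫ 1_A(x+z) min(1, f_σ(x+z)/f_σ(x)) φ_σ(z) dz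
            + 1_A(x) (1 − ∫ min(1, f_σ(x+z)/f_σ(x)) φ_σ(z) dz)`. -/
noncomputable def rwmProb (σ x : ℝ) (A : Set ℝ) : ℝ :=
  (∫ z, A.indicator (fun _ => (1 : ℝ)) (x + z)
      * min 1 (mixDensity σ (x + z) / mixDensity σ x) * gaussDensity σ z)
  + A.indicator (fun _ => (1 : ℝ)) x
      * (1 - ∫ z, min 1 (mixDensity σ (x + z) / mixDensity σ x) * gaussDensity σ z)

/-- The conductance `Φ_σ` of the half line `(-∞,0)`:
`Φ_σ = 2 ∫_{(-∞,0)} K_σ(x,[0,∞)) f_σ(x) dx`. -/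
noncomputable def PhiHalf (σ : ℝ) : ℝ :=
  2 * ∫ x in Set.Iio (0 : ℝ), rwmProb σ x (Set.Ici 0) * mixDensity σ x

/-- The `N(0,σ²)` measure, defined via its density `φ_σ` w.r.t. Lebesgue measure. -/
noncomputable def gaussMeasure (σ : ℝ) : Measure ℝ :=
  volume.withDensity fun z => ENNReal.ofReal (gaussDensity σ z)

/-- The random-walk Metropolis kernel `K_σ(x, ·)` as a measure: the accepted-move part
has density `min(1, f_σ(y)/f_σ(x))` w.r.t. the proposal `x + N(0,σ²)`, and the
remaining mass `1 − ∫ min(1, f_σ(x+z)/f_σ(x)) φ_σ(z) dz` stays at `x`. -/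
noncomputable def rwmKernel (σ : ℝ) (x : ℝ) : Measure ℝ :=
  ((gaussMeasure σ).map (fun z => x + z)).withDensity
      (fun y => ENNReal.ofReal (min 1 (mixDensity σ y / mixDensity σ x)))
  + (ENNReal.ofReal
      (1 - ∫ z, min 1 (mixDensity σ (x + z) / mixDensity σ x) * gaussDensity σ z))
      • Measure.dirac x

/-- The restricted Metropolis–Hastings kernel `K̂_σ` on `(-∞,0)`:
`K̂_σ(x,A) = K_σ(x, A ∩ (-∞,0)) + 1_A(x) K_σ(x,[0,∞))`. -/
noncomputable def rwmKernelHat (σ : ℝ) (x : ℝ) : Measure ℝ :=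
  (rwmKernel σ x).restrict (Set.Iio 0) + (rwmKernel σ x (Set.Ici 0)) • Measure.dirac x

/-- `n`-step iterate of a (measure-valued) transition kernel. -/
noncomputable def kiter {α : Type*} [MeasurableSpace α] (κ : α → Measure α) :
    ℕ → α → Measure α
  | 0 => fun x => Measure.dirac x
  | n + 1 => fun x => (kiter κ n x).bind κ

/-- The restriction `π_σ|_{(-∞,0)}`, the probability measure on `(-∞,0)` with density `2 f_σ`. -/
noncomputable def piHalf (σ : ℝ) : Measure ℝ :=
  (volume.restrict (Set.Iio 0)).withDensity fun x => ENNReal.ofReal (2 * mixDensity σ x)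

section Harris

open ProbabilityTheory

variable {α : Type*} [MeasurableSpace α]

/-- If `a u + b v ≥ 0` on a set of full measure, then the mass of a common component `m` of two
probability measures bounds `∫ a + ∫ b` from below. -/
theorem integral_add_integral_le_of_le {μ₁ μ₂ m : Measure α} [IsProbabilityMeasure μ₁]
    [IsProbabilityMeasure μ₂] {S : Set α} {a b : α → ℝ} (h₁ : m ≤ μ₁) (h₂ : m ≤ μ₂)
    (hS₁ : ∀ᵐ u ∂μ₁, u ∈ S) (hS₂ : ∀ᵐ u ∂μ₂, u ∈ S) (hm : m.real univ < 1)
    (ha : Integrable a μ₁) (hb : Integrable b μ₂)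
    (hab : ∀ u ∈ S, ∀ v ∈ S, 0 ≤ a u + b v) :
    ∫ u, a u ∂m + ∫ u, b u ∂m ≤ ∫ u, a u ∂μ₁ + ∫ u, b u ∂μ₂ := by
  have : IsFiniteMeasure m := isFiniteMeasure_of_le μ₁ h₁
  have ham := ha.mono_measure h₁
  have hbm := hb.mono_measure h₂
  have key : ∀ v ∈ S, 0 ≤ (∫ u, a u ∂μ₁ - ∫ u, a u ∂m) + (1 - m.real univ) * b v := by
    intro v hv
    have := integral_mono_measure h₁ (f := fun u => a u + b v)
      (by filter_upwards [hS₁] with u hu using hab u hu v hv) (ha.add (integrable_const _))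
    rw [integral_add ham (integrable_const _), integral_add ha (integrable_const _)] at this
    simp at this
    linarith
  have := integral_mono_measure h₂
    (f := fun v => (∫ u, a u ∂μ₁ - ∫ u, a u ∂m) + (1 - m.real univ) * b v)
    (by filter_upwards [hS₂] with v hv using key v hv)
    ((integrable_const _).add (hb.const_mul _))
  rw [integral_add (integrable_const _) (hbm.const_mul _),
    integral_add (integrable_const _) (hb.const_mul _), integral_const_mul,
    integral_const_mul] at this
  simp at this
  nlinarith

theorem integral_affine {μ : Measure α} [IsProbabilityMeasure μ] {V g : α → ℝ}
    (hV : Integrable V μ) (hg : Integrable g μ) (a b d : ℝ) :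
    ∫ u, (a + b * V u + d * g u) ∂μ = a + b * ∫ u, V u ∂μ + d * ∫ u, g u ∂μ := by
  have h1 : Integrable (fun u => a + b * V u) μ := (integrable_const a).add (hV.const_mul b)
  rw [integral_add h1 (hg.const_mul d), integral_add (integrable_const a) (hV.const_mul b),
    integral_const_mul, integral_const_mul]
  simp

/-- Drift and minorization conditions for the kernel `κ` on the absorbing set `S`, with Lyapunov
function `V`. -/
structure IsHarris (κ : Kernel α α) (S : Set α) (V : α → ℝ) (γ K ε : ℝ) : Prop where
  ae_mem : ∀ x ∈ S, ∀ᵐ y ∂κ x, y ∈ S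
  nonneg : ∀ x, 0 ≤ V x
  integrable : ∀ x ∈ S, Integrable V (κ x)
  drift : ∀ x ∈ S, ∫ y, V y ∂κ x ≤ γ * V x + K
  minor : ∃ m : Measure α, m.real univ = ε ∧ ∀ x ∈ S, V x ≤ 4 * K / (1 - γ) → m ≤ κ x

/-- The contraction rate in Harris' theorem. -/
noncomputable def harrisRate (γ ε : ℝ) : ℝ := max (1 - ε / 4) ((3 + γ) / 4)

variable {κ : Kernel α α} [IsMarkovKernel κ] {S : Set α} {V : α → ℝ} {γ K ε : ℝ}

/-- One application of the kernel contracts the weighted oscillation seminorm. -/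
theorem IsHarris.contract (h : IsHarris κ S V γ K ε) (hγ1 : γ < 1)
    (hK : 0 < K) (hε : 0 < ε) (hε1 : ε < 1) {g : α → ℝ} (hg : ∀ x ∈ S, Integrable g (κ x))
    {c : ℝ} (hc : 0 ≤ c)
    (hosc : ∀ x ∈ S, ∀ y ∈ S, g x - g y ≤ c * (2 + ε / (2 * K) * (V x + V y))) :
    ∀ x ∈ S, ∀ y ∈ S, ∫ u, g u ∂κ x - ∫ u, g u ∂κ y ≤
      (harrisRate γ ε * c) * (2 + ε / (2 * K) * (V x + V y)) := by
  intro x hx y hy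
  set β := ε / (2 * K) with hβ
  have hβ0 : 0 < β := by positivity
  have hβK : β * K = ε / 2 := by rw [hβ]; field_simp
  have ha : Integrable (fun u => c * (1 + β * V u) - g u) (κ x) :=
    (((integrable_const _).add ((h.integrable x hx).const_mul _)).const_mul _).sub (hg x hx)
  have hb : Integrable (fun u => c * (1 + β * V u) + g u) (κ y) :=
    (((integrable_const _).add ((h.integrable y hy).const_mul _)).const_mul _).add (hg y hy)
  have hab : ∀ u ∈ S, ∀ v ∈ S,
      0 ≤ (c * (1 + β * V u) - g u) + (c * (1 + β * V v) + g v) := by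
    intro u hu v hv
    linarith [hosc u hu v hv]
  have hIa : ∫ u, (c * (1 + β * V u) - g u) ∂κ x
      = c * (1 + β * ∫ u, V u ∂κ x) - ∫ u, g u ∂κ x := by
    refine (integral_congr_ae (ae_of_all _ fun u => ?_)).trans
      ((integral_affine (h.integrable x hx) (hg x hx) c (c * β) (-1)).trans (by ring))
    ring
  have hIb : ∫ u, (c * (1 + β * V u) + g u) ∂κ y
      = c * (1 + β * ∫ u, V u ∂κ y) + ∫ u, g u ∂κ y := by
    refine (integral_congr_ae (ae_of_all _ fun u => ?_)).trans
      ((integral_affine (h.integrable y hy) (hg y hy) c (c * β) 1).trans (by ring))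
    ring
  have hdx := h.drift x hx
  have hdy := h.drift y hy
  have hVx := h.nonneg x
  have hVy := h.nonneg y
  have hα1 : 1 - ε / 4 ≤ harrisRate γ ε := le_max_left _ _
  have hα2 : (3 + γ) / 4 ≤ harrisRate γ ε := le_max_right _ _
  set r := harrisRate γ ε
  set s := V x + V y with hs
  have hPV : β * (∫ u, V u ∂κ x + ∫ u, V u ∂κ y) ≤ γ * (β * s) + ε := by
    have : β * (∫ u, V u ∂κ x + ∫ u, V u ∂κ y) ≤ β * (γ * s + 2 * K) := by
      refine mul_le_mul_of_nonneg_left ?_ hβ0.le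
      rw [hs, mul_add]; linarith
    linarith [mul_add β (γ * s) (2 * K)]
  have hβs : 0 ≤ β * s := by positivity
  rw [mul_comm r c, mul_assoc]
  by_cases hR : s ≤ 4 * K / (1 - γ)
  · obtain ⟨m, hmass, hm⟩ := h.minor
    have hmx := hm x hx (by linarith)
    have hmy := hm y hy (by linarith)
    have : IsFiniteMeasure m := isFiniteMeasure_of_le (κ x) hmx
    have := integral_add_integral_le_of_le hmx hmy (h.ae_mem x hx) (h.ae_mem y hy)
      (by rw [hmass]; exact hε1) ha hb hab
    rw [← integral_add (ha.mono_measure hmx) (hb.mono_measure hmy), hIa, hIb] at this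
    have h2 : c * (2 * ε) ≤ ∫ u, ((c * (1 + β * V u) - g u) + (c * (1 + β * V u) + g u)) ∂m := by
      have h3 : ∫ _, 2 * c ∂m ≤
          ∫ u, ((c * (1 + β * V u) - g u) + (c * (1 + β * V u) + g u)) ∂m := by
        refine integral_mono (integrable_const _)
          ((ha.mono_measure hmx).add (hb.mono_measure hmy)) fun u => ?_
        have := mul_nonneg hc (mul_nonneg hβ0.le (h.nonneg u))
        dsimp only
        linarith
      simp only [integral_const, hmass, smul_eq_mul] at h3
      linarith
    have h4 : ∫ u, g u ∂κ x - ∫ u, g u ∂κ y ≤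
        c * (2 - 2 * ε + β * (∫ u, V u ∂κ x + ∫ u, V u ∂κ y)) := by linarith
    refine h4.trans (mul_le_mul_of_nonneg_left ?_ hc)
    nlinarith
  · push Not at hR
    rw [div_lt_iff₀ (by linarith)] at hR
    have := integral_add_integral_le_of_le (m := 0) (Measure.zero_le _) (Measure.zero_le _)
      (h.ae_mem x hx) (h.ae_mem y hy) (by simp) ha hb hab
    rw [hIa, hIb] at this
    simp at this
    have h4 : ∫ u, g u ∂κ x - ∫ u, g u ∂κ y ≤
        c * (2 + β * (∫ u, V u ∂κ x + ∫ u, V u ∂κ y)) := by linarith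
    refine h4.trans (mul_le_mul_of_nonneg_left ?_ hc)
    have h5 : 2 * ε ≤ (1 - γ) * (β * s) := by nlinarith
    nlinarith

/-- The iterates `kiter κ n` form a Markov kernel. -/
theorem exists_kernel_eq_kiter (κ : Kernel α α) [IsMarkovKernel κ] (n : ℕ) :
    ∃ η : Kernel α α, IsMarkovKernel η ∧ ∀ x, η x = kiter κ n x := by
  induction n with
  | zero => exact ⟨Kernel.id, inferInstance, fun x => by simp [kiter, Kernel.id_apply]⟩
  | succ n ih =>
    obtain ⟨η, hη, h⟩ := ih
    exact ⟨κ ∘ₖ η, inferInstance, fun x => by rw [Kernel.comp_apply, h]; rfl⟩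

theorem integrable_of_abs_le_one {μ : Measure α} [IsFiniteMeasure μ] {g : α → ℝ}
    (hg : Measurable g) (hb : ∀ x, |g x| ≤ 1) : Integrable g μ :=
  Integrable.of_bound hg.aestronglyMeasurable (C := 1) (ae_of_all _ hb)

theorem abs_integral_le_one {μ : Measure α} [IsProbabilityMeasure μ] {g : α → ℝ}
    (hb : ∀ x, |g x| ≤ 1) : |∫ x, g x ∂μ| ≤ 1 := by
  simpa using norm_integral_le_of_norm_le_const (μ := μ) (f := g) (C := 1) (ae_of_all _ hb)

theorem measurable_integral_kernel (κ : Kernel α α) [IsMarkovKernel κ] {g : α → ℝ}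
    (hg : Measurable g) : Measurable fun x => ∫ u, g u ∂κ x :=
  (hg.stronglyMeasurable.integral_kernel).measurable

theorem integral_bind_kernel (κ : Kernel α α) {μ : Measure α} {g : α → ℝ}
    (hg : Integrable g (μ.bind κ)) : ∫ u, g u ∂μ.bind κ = ∫ y, ∫ u, g u ∂κ y ∂μ := by
  have e : (κ ∘ₖ Kernel.const Unit μ) () = μ.bind κ := by
    rw [Kernel.comp_apply, Kernel.const_apply]
  rw [← e] at hg ⊢
  simpa using Kernel.integral_comp hg

theorem integral_kiter_succ (κ : Kernel α α) [IsMarkovKernel κ] (n : ℕ) (x : α) {g : α → ℝ}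
    (hg : Measurable g) (hb : ∀ x, |g x| ≤ 1) :
    ∫ u, g u ∂kiter κ (n + 1) x = ∫ y, ∫ u, g u ∂κ y ∂kiter κ n x := by
  obtain ⟨η, hη, h⟩ := exists_kernel_eq_kiter κ n
  have : kiter κ (n + 1) x = (kiter κ n x).bind κ := rfl
  rw [this, ← h]
  exact integral_bind_kernel κ (integrable_of_abs_le_one hg hb)

/-- Geometric decay of the weighted oscillation along the iterates. -/
theorem IsHarris.integral_kiter_sub_le (h : IsHarris κ S V γ K ε) (hγ : 0 ≤ γ) (hγ1 : γ < 1)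
    (hK : 0 < K) (hε : 0 < ε) (hε1 : ε < 1) (n : ℕ) {g : α → ℝ} (hg : Measurable g)
    (hb : ∀ x, |g x| ≤ 1) {c : ℝ} (hc : 0 ≤ c)
    (hosc : ∀ x ∈ S, ∀ y ∈ S, g x - g y ≤ c * (2 + ε / (2 * K) * (V x + V y))) :
    ∀ x ∈ S, ∀ y ∈ S, ∫ u, g u ∂kiter κ n x - ∫ u, g u ∂kiter κ n y ≤
      (harrisRate γ ε ^ n * c) * (2 + ε / (2 * K) * (V x + V y)) := by
  induction n generalizing g c with
  | zero =>
    intro x hx y hy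
    simpa [kiter, integral_dirac' _ _ hg.stronglyMeasurable] using hosc x hx y hy
  | succ n ih =>
    intro x hx y hy
    have hr : 0 ≤ harrisRate γ ε := le_max_of_le_right (by linarith)
    rw [integral_kiter_succ κ n x hg hb, integral_kiter_succ κ n y hg hb, pow_succ,
      mul_assoc (_ ^ n)]
    exact ih (measurable_integral_kernel κ hg) (fun x => abs_integral_le_one hb)
      (mul_nonneg hr hc)
      (h.contract hγ1 hK hε hε1 (fun x _ => integrable_of_abs_le_one hg hb) hc hosc) x hx y hy

theorem integral_kiter_invariant {π : Measure α} [IsProbabilityMeasure π]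
    (hπ : π.bind κ = π) (n : ℕ) {g : α → ℝ} (hg : Measurable g) (hb : ∀ x, |g x| ≤ 1) :
    ∫ x, ∫ u, g u ∂kiter κ n x ∂π = ∫ u, g u ∂π := by
  induction n generalizing g with
  | zero => simp [kiter, integral_dirac' _ _ hg.stronglyMeasurable]
  | succ n ih =>
    simp_rw [fun x => integral_kiter_succ κ n x hg hb]
    rw [ih (measurable_integral_kernel κ hg) (fun x => abs_integral_le_one hb)]
    conv_rhs => rw [← hπ]
    exact (integral_bind_kernel κ (integrable_of_abs_le_one hg hb)).symm

/-- Harris' theorem: quantitative convergence to the invariant measure in total variation. -/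
theorem IsHarris.abs_kiter_sub_le (h : IsHarris κ S V γ K ε) (hγ : 0 ≤ γ) (hγ1 : γ < 1)
    (hK : 0 < K) (hε : 0 < ε) (hε1 : ε < 1) {π : Measure α} [IsProbabilityMeasure π]
    (hπ : π.bind κ = π) (hπS : ∀ᵐ y ∂π, y ∈ S) (hπV : Integrable V π) (n : ℕ) {B : Set α}
    (hB : MeasurableSet B) {x : α} (hx : x ∈ S) :
    |(kiter κ n x B).toReal - (π B).toReal| ≤
      harrisRate γ ε ^ n * (2 + ε / (2 * K) * (V x + ∫ y, V y ∂π)) := by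
  have hg : Measurable (B.indicator fun _ => (1 : ℝ)) := measurable_const.indicator hB
  have hb : ∀ x, |B.indicator (fun _ => (1 : ℝ)) x| ≤ 1 := by
    intro x; by_cases hx : x ∈ B <;> simp [hx]
  have hosc : ∀ x ∈ S, ∀ y ∈ S, B.indicator (fun _ => (1 : ℝ)) x - B.indicator (fun _ => 1) y ≤
      1 * (2 + ε / (2 * K) * (V x + V y)) := by
    intro x _ y _
    have := mul_nonneg (div_pos hε (mul_pos two_pos hK)).le
      (add_nonneg (h.nonneg x) (h.nonneg y))
    linarith [abs_le.1 (hb x), abs_le.1 (hb y)]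
  have main := h.integral_kiter_sub_le hγ hγ1 hK hε hε1 n hg hb zero_le_one hosc
  have hinv := integral_kiter_invariant hπ n hg hb
  obtain ⟨η, hη, hηk⟩ := exists_kernel_eq_kiter κ n
  simp_rw [← hηk] at main hinv ⊢
  have hint : Integrable (fun y => ∫ u, B.indicator (fun _ => (1 : ℝ)) u ∂η y) π :=
    integrable_of_abs_le_one (measurable_integral_kernel η hg) fun y => abs_integral_le_one hb
  have hW : Integrable (fun y => harrisRate γ ε ^ n * 1 * (2 + ε / (2 * K) * (V x + V y))) π :=
    ((integrable_const _).add (((integrable_const _).add hπV).const_mul _)).const_mul _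
  have hIW : ∫ y, harrisRate γ ε ^ n * 1 * (2 + ε / (2 * K) * (V x + V y)) ∂π =
      harrisRate γ ε ^ n * (2 + ε / (2 * K) * (V x + ∫ y, V y ∂π)) := by
    refine (integral_congr_ae (ae_of_all _ fun y => ?_)).trans
      ((integral_affine hπV hπV (harrisRate γ ε ^ n * (2 + ε / (2 * K) * V x))
        (harrisRate γ ε ^ n * (ε / (2 * K))) 0).trans (by ring))
    ring
  have e1 : (η x B).toReal = ∫ u, B.indicator (fun _ => (1 : ℝ)) u ∂η x := by
    rw [integral_indicator_const _ hB]; simp [Measure.real]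
  have e2 : (π B).toReal = ∫ y, ∫ u, B.indicator (fun _ => (1 : ℝ)) u ∂η y ∂π := by
    rw [hinv, integral_indicator_const _ hB]; simp [Measure.real]
  rw [e1, e2, ← hIW, abs_le]
  constructor
  · rw [← sub_nonneg, sub_neg_eq_add]
    have : 0 ≤ ∫ y, ((∫ u, B.indicator (fun _ => (1 : ℝ)) u ∂η x)
        - (∫ u, B.indicator (fun _ => (1 : ℝ)) u ∂η y)
        + harrisRate γ ε ^ n * 1 * (2 + ε / (2 * K) * (V x + V y))) ∂π := by
      refine integral_nonneg_of_ae ?_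
      filter_upwards [hπS] with y hy
      have := main y hy x hx
      rw [add_comm (V y)] at this
      simp only [Pi.zero_apply]
      linarith
    have h1 := (integrable_const (μ := π) (∫ u, B.indicator (fun _ => (1 : ℝ)) u ∂η x)).sub hint
    refine this.trans_eq ((integral_add h1 hW).trans ?_)
    congr 1
    rw [Pi.sub_def, integral_sub (integrable_const _) hint]
    simp
  · have : ∫ y, ((∫ u, B.indicator (fun _ => (1 : ℝ)) u ∂η x)
        - (∫ u, B.indicator (fun _ => (1 : ℝ)) u ∂η y)) ∂π ≤
        ∫ y, harrisRate γ ε ^ n * 1 * (2 + ε / (2 * K) * (V x + V y)) ∂π := by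
      refine integral_mono_ae ((integrable_const _).sub hint) hW ?_
      filter_upwards [hπS] with y hy using main x hx y hy
    rw [integral_sub (integrable_const _) hint] at this
    simpa using this

end Harris

section Kernel

theorem gaussDensity_eq_gaussianPDFReal (σ x : ℝ) :
    gaussDensity σ x = ProbabilityTheory.gaussianPDFReal 0 (σ ^ 2).toNNReal x := by
  simp [gaussDensity, ProbabilityTheory.gaussianPDFReal, Real.coe_toNNReal _ (sq_nonneg σ)]

theorem gaussDensity_pos {σ : ℝ} (hσ : 0 < σ) (x : ℝ) : 0 < gaussDensity σ x := by
  unfold gaussDensity; positivity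

theorem continuous_gaussDensity (σ : ℝ) : Continuous (gaussDensity σ) := by
  unfold gaussDensity; fun_prop

theorem integrable_gaussDensity (σ : ℝ) : Integrable (gaussDensity σ) := by
  rw [funext (gaussDensity_eq_gaussianPDFReal σ)]
  exact ProbabilityTheory.integrable_gaussianPDFReal _ _

theorem integral_gaussDensity {σ : ℝ} (hσ : 0 < σ) : ∫ x, gaussDensity σ x = 1 := by
  simp_rw [gaussDensity_eq_gaussianPDFReal σ]
  exact ProbabilityTheory.integral_gaussianPDFReal_eq_one _
    (Real.toNNReal_pos.2 (by positivity)).ne'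

theorem mixDensity_pos {σ : ℝ} (hσ : 0 < σ) (x : ℝ) : 0 < mixDensity σ x := by
  have h1 := gaussDensity_pos hσ (x + 1)
  have h2 := gaussDensity_pos hσ (x - 1)
  unfold mixDensity; positivity

theorem continuous_mixDensity (σ : ℝ) : Continuous (mixDensity σ) := by
  have := continuous_gaussDensity σ
  unfold mixDensity; fun_prop

/-- Lebesgue density of the accepted moves of the Metropolis kernel started at `x`. -/
noncomputable def acceptDensity (σ x y : ℝ) : ℝ :=
  min 1 (mixDensity σ y / mixDensity σ x) * gaussDensity σ (y - x)

theorem acceptDensity_nonneg {σ : ℝ} (hσ : 0 < σ) (x y : ℝ) : 0 ≤ acceptDensity σ x y := by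
  have h1 := mixDensity_pos hσ x
  have h2 := mixDensity_pos hσ y
  have h3 := gaussDensity_pos hσ (y - x)
  unfold acceptDensity; positivity

theorem acceptDensity_le {σ : ℝ} (hσ : 0 < σ) (x y : ℝ) :
    acceptDensity σ x y ≤ gaussDensity σ (y - x) :=
  mul_le_of_le_one_left (gaussDensity_pos hσ _).le (min_le_left _ _)

theorem continuous_acceptDensity {σ : ℝ} (hσ : 0 < σ) :
    Continuous fun p : ℝ × ℝ => acceptDensity σ p.1 p.2 := by
  have h1 := continuous_mixDensity σ
  have h2 := continuous_gaussDensity σ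
  have h3 : ∀ p : ℝ × ℝ, mixDensity σ p.1 ≠ 0 := fun p => (mixDensity_pos hσ _).ne'
  unfold acceptDensity
  exact (continuous_const.min ((h1.comp continuous_snd).div (h1.comp continuous_fst) h3)).mul
    (h2.comp (continuous_snd.sub continuous_fst))

theorem continuous_acceptDensity_right (σ x : ℝ) :
    Continuous (acceptDensity σ x) := by
  have h1 := continuous_mixDensity σ
  have h2 := continuous_gaussDensity σ
  unfold acceptDensity
  fun_prop

theorem integrable_acceptDensity {σ : ℝ} (hσ : 0 < σ) (x : ℝ) :
    Integrable (acceptDensity σ x) :=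
  ((integrable_gaussDensity σ).comp_sub_right x).mono'
    (continuous_acceptDensity_right σ x).aestronglyMeasurable
    (ae_of_all _ fun y => by
      rw [Real.norm_of_nonneg (acceptDensity_nonneg hσ x y)]; exact acceptDensity_le hσ x y)

theorem integral_acceptDensity_le {σ : ℝ} (hσ : 0 < σ) (x : ℝ) :
    ∫ y, acceptDensity σ x y ≤ 1 := by
  rw [← integral_gaussDensity hσ, ← integral_sub_right_eq_self (gaussDensity σ) x]
  exact integral_mono (integrable_acceptDensity hσ x)
    ((integrable_gaussDensity σ).comp_sub_right x) (acceptDensity_le hσ x)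

theorem integral_accept_shift (σ x : ℝ) :
    ∫ z, min 1 (mixDensity σ (x + z) / mixDensity σ x) * gaussDensity σ z =
      ∫ y, acceptDensity σ x y := by
  rw [← integral_add_left_eq_self (acceptDensity σ x) x]
  simp [acceptDensity]

theorem map_gaussMeasure (σ x : ℝ) :
    (gaussMeasure σ).map (fun z => x + z) =
      volume.withDensity fun y => ENNReal.ofReal (gaussDensity σ (y - x)) := by
  ext B hB
  have hB' : MeasurableSet ((fun z => x + z) ⁻¹' B) := hB.preimage (by fun_prop)
  rw [Measure.map_apply (by fun_prop) hB, gaussMeasure, withDensity_apply _ hB',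
    withDensity_apply _ hB, ← lintegral_indicator hB', ← lintegral_indicator hB,
    ← lintegral_add_left_eq_self (B.indicator _) x]
  congr 1; ext z
  simp only [indicator, add_sub_cancel_left]
  rfl

theorem rwmKernel_eq {σ : ℝ} (hσ : 0 < σ) (x : ℝ) :
    rwmKernel σ x = volume.withDensity (fun y => ENNReal.ofReal (acceptDensity σ x y)) +
      ENNReal.ofReal (1 - ∫ y, acceptDensity σ x y) • Measure.dirac x := by
  have h1 := (continuous_mixDensity σ).measurable
  have h2 := (continuous_gaussDensity σ).measurable
  rw [rwmKernel, integral_accept_shift, map_gaussMeasure, ← withDensity_mul _ (by fun_prop)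
    (by fun_prop)]
  congr 2
  ext y
  rw [Pi.mul_apply, acceptDensity, ← ENNReal.ofReal_mul (gaussDensity_pos hσ _).le, mul_comm]

/-- Probability that the restricted chain stays put at `x`. -/
noncomputable def holdMass (σ x : ℝ) : ENNReal :=
  1 - ∫⁻ y in Iio 0, ENNReal.ofReal (acceptDensity σ x y)

theorem lintegral_acceptDensity_le {σ : ℝ} (hσ : 0 < σ) (x : ℝ) :
    ∫⁻ y in Iio 0, ENNReal.ofReal (acceptDensity σ x y) ≤ 1 := by
  refine (setLIntegral_le_lintegral _ _).trans ?_
  rw [← ofReal_integral_eq_lintegral_ofReal (integrable_acceptDensity hσ x)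
    (ae_of_all _ (acceptDensity_nonneg hσ x))]
  simpa using integral_acceptDensity_le hσ x

theorem holdMass_eq {σ : ℝ} (hσ : 0 < σ) (x : ℝ) :
    holdMass σ x = ENNReal.ofReal (1 - ∫ y, acceptDensity σ x y) +
      ∫⁻ y in Ici 0, ENNReal.ofReal (acceptDensity σ x y) := by
  have hle := lintegral_acceptDensity_le hσ x
  have h1 : ∫⁻ y, ENNReal.ofReal (acceptDensity σ x y) =
      ENNReal.ofReal (∫ y, acceptDensity σ x y) :=
    (ofReal_integral_eq_lintegral_ofReal (integrable_acceptDensity hσ x)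
      (ae_of_all _ (acceptDensity_nonneg hσ x))).symm
  have h2 := lintegral_add_compl (μ := volume)
    (fun y => ENNReal.ofReal (acceptDensity σ x y)) (measurableSet_Iio (a := (0 : ℝ)))
  rw [compl_Iio] at h2
  refine ENNReal.sub_eq_of_eq_add_rev (ne_top_of_le_ne_top ENNReal.one_ne_top hle) ?_
  rw [add_comm (ENNReal.ofReal _), ← add_assoc, h2, h1,
    ← ENNReal.ofReal_add (integral_nonneg (acceptDensity_nonneg hσ x))
      (sub_nonneg.2 (integral_acceptDensity_le hσ x))]
  simp

theorem rwmKernelHat_eq {σ : ℝ} (hσ : 0 < σ) (x : ℝ) :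
    rwmKernelHat σ x =
      (volume.restrict (Iio 0)).withDensity (fun y => ENNReal.ofReal (acceptDensity σ x y)) +
        holdMass σ x • Measure.dirac x := by
  ext B hB
  rw [rwmKernelHat, rwmKernel_eq hσ, holdMass_eq hσ]
  simp only [Measure.add_apply, Measure.smul_apply, smul_eq_mul, Measure.restrict_apply hB,
    withDensity_apply _ measurableSet_Ici, withDensity_apply _ (hB.inter measurableSet_Iio),
    withDensity_apply _ hB, Measure.restrict_restrict hB, Measure.dirac_apply' _ hB,
    Measure.dirac_apply' _ measurableSet_Ici, Measure.dirac_apply' _ (hB.inter measurableSet_Iio)]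
  by_cases hx : x < 0 <;> by_cases hxB : x ∈ B <;>
    simp [indicator, hx, hxB, not_le.2, not_lt.1, add_assoc, add_comm, add_left_comm]

theorem measurable_holdMass {σ : ℝ} (hσ : 0 < σ) : Measurable (holdMass σ) :=
  measurable_const.sub <| Measurable.lintegral_prod_right'
    (f := fun p : ℝ × ℝ => ENNReal.ofReal (acceptDensity σ p.1 p.2))
    (continuous_acceptDensity hσ).measurable.ennreal_ofReal

theorem rwmKernelHat_apply {σ : ℝ} (hσ : 0 < σ) (x : ℝ) {B : Set ℝ} (hB : MeasurableSet B) :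
    rwmKernelHat σ x B = (∫⁻ y in B ∩ Iio 0, ENNReal.ofReal (acceptDensity σ x y)) +
      B.indicator (holdMass σ) x := by
  rw [rwmKernelHat_eq hσ, Measure.add_apply, withDensity_apply _ hB, Measure.smul_apply,
    Measure.dirac_apply' _ hB, smul_eq_mul, Measure.restrict_restrict hB]
  by_cases hx : x ∈ B <;> simp [hx]

theorem measurable_rwmKernelHat {σ : ℝ} (hσ : 0 < σ) : Measurable (rwmKernelHat σ) := by
  refine Measure.measurable_of_measurable_coe _ fun B hB => ?_
  simp_rw [rwmKernelHat_apply hσ _ hB]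
  have h1 := Measurable.lintegral_prod_right' (ν := volume.restrict (B ∩ Iio 0))
    (continuous_acceptDensity hσ).measurable.ennreal_ofReal
  exact h1.add ((measurable_holdMass hσ).indicator hB)

/-- The restricted Metropolis chain as a bundled kernel. -/
noncomputable def hatKernel {σ : ℝ} (hσ : 0 < σ) : ProbabilityTheory.Kernel ℝ ℝ :=
  ⟨rwmKernelHat σ, measurable_rwmKernelHat hσ⟩

theorem isProbabilityMeasure_rwmKernelHat {σ : ℝ} (hσ : 0 < σ) (x : ℝ) :
    IsProbabilityMeasure (rwmKernelHat σ x) := by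
  constructor
  rw [rwmKernelHat_eq hσ, Measure.add_apply, withDensity_apply _ MeasurableSet.univ]
  simp [holdMass, add_tsub_cancel_of_le (lintegral_acceptDensity_le hσ x)]

instance isMarkovKernel_hatKernel {σ : ℝ} (hσ : 0 < σ) :
    ProbabilityTheory.IsMarkovKernel (hatKernel hσ) :=
  ⟨isProbabilityMeasure_rwmKernelHat hσ⟩

theorem mixDensity_mul_acceptDensity {σ : ℝ} (hσ : 0 < σ) (x y : ℝ) :
    mixDensity σ x * acceptDensity σ x y = mixDensity σ y * acceptDensity σ y x := by
  have key : ∀ x y, mixDensity σ x * acceptDensity σ x y =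
      min (mixDensity σ x) (mixDensity σ y) * gaussDensity σ (y - x) := by
    intro x y
    have h := mixDensity_pos hσ x
    rw [acceptDensity, ← mul_assoc, mul_min_of_nonneg _ _ h.le, mul_one,
      mul_div_cancel₀ _ h.ne']
  rw [key, key, min_comm]
  simp only [gaussDensity]
  ring_nf

theorem piHalf_bind {σ : ℝ} (hσ : 0 < σ) : (piHalf σ).bind (rwmKernelHat σ) = piHalf σ := by
  ext B hB
  have hf : Measurable fun x => ENNReal.ofReal (2 * mixDensity σ x) :=
    ((continuous_mixDensity σ).measurable.const_mul 2).ennreal_ofReal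
  have hq := (continuous_acceptDensity hσ).measurable.ennreal_ofReal
  have hqr : ∀ x, Measurable fun y => ENNReal.ofReal (acceptDensity σ x y) := fun x =>
    (continuous_acceptDensity_right σ x).measurable.ennreal_ofReal
  rw [Measure.bind_apply hB (measurable_rwmKernelHat hσ).aemeasurable, piHalf,
    lintegral_withDensity_eq_lintegral_mul _ hf (g := fun x => rwmKernelHat σ x B)
      ((Measure.measurable_coe hB).comp (measurable_rwmKernelHat hσ)), withDensity_apply _ hB]
  set μ : Measure ℝ := volume.restrict (Iio 0) with hμ
  have e1 : ∀ x, rwmKernelHat σ x B = (∫⁻ y in B, ENNReal.ofReal (acceptDensity σ x y) ∂μ) +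
      B.indicator (holdMass σ) x := by
    intro x
    rw [rwmKernelHat_apply hσ x hB, hμ, Measure.restrict_restrict hB]
  simp only [Pi.mul_apply, e1, mul_add]
  rw [lintegral_add_left]
  swap
  · exact hf.mul (Measurable.lintegral_prod_right'
      (f := fun p : ℝ × ℝ => ENNReal.ofReal (acceptDensity σ p.1 p.2)) hq)
  have e2 : ∫⁻ x, ENNReal.ofReal (2 * mixDensity σ x) *
      ∫⁻ y in B, ENNReal.ofReal (acceptDensity σ x y) ∂μ ∂μ =
      ∫⁻ y in B, ENNReal.ofReal (2 * mixDensity σ y) *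
        ∫⁻ x, ENNReal.ofReal (acceptDensity σ y x) ∂μ ∂μ := by
    simp_rw [← lintegral_const_mul _ (hqr _)]
    rw [lintegral_lintegral_swap]
    · congr 1; ext y
      congr 1; ext x
      rw [← ENNReal.ofReal_mul (by linarith [mixDensity_pos hσ x]),
        ← ENNReal.ofReal_mul (by linarith [mixDensity_pos hσ y]), mul_assoc, mul_assoc,
        mixDensity_mul_acceptDensity hσ x y]
    · exact ((hf.comp measurable_fst).mul hq).aemeasurable
  have e3 : ∀ x, ENNReal.ofReal (2 * mixDensity σ x) * B.indicator (holdMass σ) x =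
      B.indicator (fun x => ENNReal.ofReal (2 * mixDensity σ x) * holdMass σ x) x := by
    intro x
    by_cases hx : x ∈ B <;> simp [hx]
  rw [e2]
  simp_rw [e3]
  rw [lintegral_indicator hB, ← lintegral_add_right _
    (show Measurable fun x => ENNReal.ofReal (2 * mixDensity σ x) * holdMass σ x from
      hf.mul (measurable_holdMass hσ))]
  congr 1; ext x
  rw [← mul_add, holdMass, add_tsub_cancel_of_le (lintegral_acceptDensity_le hσ x), mul_one]

end Kernel

section Estimates

theorem exp_one_lt_three : Real.exp 1 < 3 := by linarith [Real.exp_one_lt_d9]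

theorem exp_half_le_two : Real.exp (1 / 2) ≤ 2 := by
  have h : Real.exp (1 / 2) * Real.exp (1 / 2) = Real.exp 1 := by
    rw [← Real.exp_add]; norm_num
  nlinarith [exp_one_lt_three, Real.exp_pos (1 / 2)]

theorem mul_exp_le_four_mul_exp {a b ρ : ℝ} (ha : 0 ≤ a) (h1 : ρ ≤ 1)
    (h2 : ρ ≤ 2 * Real.exp ((a ^ 2 - b ^ 2) / 2)) :
    ρ * Real.exp b ≤ 4 * Real.exp a := by
  rcases le_total b a with hba | hab
  · have := Real.exp_le_exp.2 hba
    nlinarith [Real.exp_pos b]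
  · calc ρ * Real.exp b ≤ 2 * Real.exp ((a ^ 2 - b ^ 2) / 2) * Real.exp b := by gcongr
      _ = 2 * Real.exp ((a ^ 2 - b ^ 2) / 2 + b) := by rw [Real.exp_add]; ring
      _ ≤ 2 * Real.exp (1 / 2 + a) := by
        refine mul_le_mul_of_nonneg_left (Real.exp_le_exp.2 ?_) two_pos.le
        nlinarith [sq_nonneg (b - a - 1), mul_nonneg ha (sub_nonneg.2 hab)]
      _ ≤ 4 * Real.exp a := by
        rw [Real.exp_add]
        nlinarith [exp_half_le_two, Real.exp_pos a]

theorem mul_exp_sub_exp_le {a b ρ : ℝ} (ha : 1 < a) (h0 : 0 ≤ ρ)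
    (h2 : ρ ≤ 2 * Real.exp ((a ^ 2 - b ^ 2) / 2)) :
    ρ * (Real.exp b - Real.exp a) ≤ 2 / (a - 1) * Real.exp a := by
  have ha' : 0 < a - 1 := by linarith
  rcases le_total b a with hba | hab
  · have := Real.exp_le_exp.2 hba
    have h3 : 0 ≤ 2 / (a - 1) * Real.exp a := by positivity
    nlinarith
  · have hu : 0 ≤ b - a := sub_nonneg.2 hab
    have e1 : Real.exp b - Real.exp a ≤ (b - a) * Real.exp b := by
      have h4 : Real.exp a = Real.exp b * Real.exp (a - b) := by rw [← Real.exp_add]; ring_nf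
      have := Real.add_one_le_exp (a - b)
      nlinarith [Real.exp_pos b]
    have e2 : (b - a) * Real.exp (-((a - 1) * (b - a))) ≤ 1 / (a - 1) := by
      rw [Real.exp_neg, ← div_eq_mul_inv, div_le_div_iff₀ (Real.exp_pos _) ha']
      linarith [Real.add_one_le_exp ((a - 1) * (b - a))]
    calc ρ * (Real.exp b - Real.exp a)
        ≤ 2 * Real.exp ((a ^ 2 - b ^ 2) / 2) * ((b - a) * Real.exp b) := by
          refine mul_le_mul h2 e1 (sub_nonneg.2 (Real.exp_le_exp.2 hab)) (by positivity)
      _ = 2 * (b - a) * Real.exp ((a ^ 2 - b ^ 2) / 2 + b) := by rw [Real.exp_add]; ring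
      _ ≤ 2 * (b - a) * Real.exp (-((a - 1) * (b - a)) + a) := by
        refine mul_le_mul_of_nonneg_left (Real.exp_le_exp.2 ?_) (by positivity)
        nlinarith [sq_nonneg (b - a)]
      _ = 2 * ((b - a) * Real.exp (-((a - 1) * (b - a)))) * Real.exp a := by
        rw [Real.exp_add]; ring
      _ ≤ 2 * (1 / (a - 1)) * Real.exp a := by gcongr
      _ = 2 / (a - 1) * Real.exp a := by ring

theorem mul_exp_sub_exp_le_neg {a b ρ : ℝ} (hab : b ≤ a - 1) (h : 1 / 2 ≤ ρ) :
    ρ * (Real.exp b - Real.exp a) ≤ -(1 / 4) * Real.exp a := by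
  have h1 : Real.exp b ≤ Real.exp a * Real.exp (-1) := by
    rw [← Real.exp_add]; exact Real.exp_le_exp.2 (by linarith)
  have h2 : Real.exp (-1) ≤ 1 / 2 := by
    rw [Real.exp_neg, ← one_div]
    exact one_div_le_one_div_of_le two_pos (by linarith [Real.add_one_le_exp (1 : ℝ)])
  have h3 : Real.exp b ≤ Real.exp a * (1 / 2) :=
    h1.trans (mul_le_mul_of_nonneg_left h2 (Real.exp_pos _).le)
  nlinarith [Real.exp_pos a]

theorem gaussDensity_eq_mul_exp (σ s t : ℝ) :
    gaussDensity σ t = gaussDensity σ s * Real.exp (((|s| / σ) ^ 2 - (|t| / σ) ^ 2) / 2) := by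
  rw [gaussDensity, gaussDensity, mul_assoc (_⁻¹), ← Real.exp_add]
  congr 2
  rw [div_pow, div_pow, sq_abs, sq_abs]
  ring

theorem gaussDensity_le_of_abs_le (σ : ℝ) {s t : ℝ} (h : |s| ≤ |t|) :
    gaussDensity σ t ≤ gaussDensity σ s := by
  unfold gaussDensity
  have := sq_le_sq.2 h
  gcongr ?_ * Real.exp (-?_ / _)

theorem exp_div_le_gaussDensity {σ M z : ℝ} (hσ : 0 < σ) (hz : |z| ≤ M * σ) :
    Real.exp (-(M ^ 2) / 2) / (3 * σ) ≤ gaussDensity σ z := by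
  have h1 : Real.sqrt (2 * Real.pi * σ ^ 2) ≤ 3 * σ :=
    Real.sqrt_le_iff.2 ⟨by positivity, by nlinarith [Real.pi_lt_four, sq_nonneg σ]⟩
  have h2 : -(M ^ 2) / 2 ≤ -(z ^ 2) / (2 * σ ^ 2) := by
    have : z ^ 2 ≤ (M * σ) ^ 2 := by
      rw [← sq_abs]; exact pow_le_pow_left₀ (abs_nonneg z) hz 2
    rw [neg_div, neg_div, neg_le_neg_iff, div_le_div_iff₀ (by positivity) two_pos]
    nlinarith
  rw [gaussDensity, div_eq_inv_mul]
  gcongr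

theorem mixDensity_le {x : ℝ} (σ : ℝ) (hx : x ≤ 0) :
    mixDensity σ x ≤ gaussDensity σ (x + 1) := by
  have : gaussDensity σ (x - 1) ≤ gaussDensity σ (x + 1) :=
    gaussDensity_le_of_abs_le σ (sq_le_sq.1 (by nlinarith))
  unfold mixDensity; linarith

theorem le_mixDensity {σ : ℝ} (hσ : 0 < σ) (x : ℝ) :
    1 / 2 * gaussDensity σ (x + 1) ≤ mixDensity σ x := by
  have := gaussDensity_pos hσ (x - 1)
  unfold mixDensity; linarith

theorem le_mixDensity' {σ : ℝ} (hσ : 0 < σ) (x : ℝ) :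
    1 / 2 * gaussDensity σ (x - 1) ≤ mixDensity σ x := by
  have := gaussDensity_pos hσ (x + 1)
  unfold mixDensity; linarith

theorem mixDensity_ratio_le {σ : ℝ} (hσ : 0 < σ) {x y : ℝ} (hy : y < 0) :
    mixDensity σ y / mixDensity σ x ≤
      2 * Real.exp (((|x + 1| / σ) ^ 2 - (|y + 1| / σ) ^ 2) / 2) := by
  rw [div_le_iff₀ (mixDensity_pos hσ x)]
  have h1 := mixDensity_le σ hy.le
  rw [gaussDensity_eq_mul_exp σ (x + 1)] at h1
  refine h1.trans ?_
  have h2 := mul_le_mul_of_nonneg_right (le_mixDensity hσ x)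
    (Real.exp_pos (((|x + 1| / σ) ^ 2 - (|y + 1| / σ) ^ 2) / 2)).le
  linarith

theorem half_le_mixDensity_ratio {σ : ℝ} (hσ : 0 < σ) {x y : ℝ} (hx : x < 0)
    (h : |y + 1| ≤ |x + 1|) : 1 / 2 ≤ mixDensity σ y / mixDensity σ x := by
  rw [le_div_iff₀ (mixDensity_pos hσ x)]
  linarith [mixDensity_le σ hx.le, le_mixDensity hσ y, gaussDensity_le_of_abs_le σ h]

/-- Lyapunov function for the restricted chain. -/
noncomputable def lyapunov (σ x : ℝ) : ℝ := Real.exp (|x + 1| / σ)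

theorem lyapunov_pos (σ x : ℝ) : 0 < lyapunov σ x := Real.exp_pos _

theorem continuous_lyapunov (σ : ℝ) : Continuous (lyapunov σ) := by
  unfold lyapunov; fun_prop

theorem lyapunov_mul_acceptDensity_le {σ : ℝ} (hσ : 0 < σ) {x y : ℝ} (hy : y < 0) :
    acceptDensity σ x y * lyapunov σ y ≤ 4 * lyapunov σ x * gaussDensity σ (y - x) := by
  have := mul_exp_le_four_mul_exp (a := |x + 1| / σ) (b := |y + 1| / σ) (by positivity)
    (min_le_left 1 (mixDensity σ y / mixDensity σ x))
    ((min_le_right _ _).trans (mixDensity_ratio_le hσ hy))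
  have := mul_le_mul_of_nonneg_right this (gaussDensity_pos hσ (y - x)).le
  unfold acceptDensity lyapunov
  linarith

theorem integral_rwmKernelHat {σ : ℝ} (hσ : 0 < σ) (x : ℝ) {g : ℝ → ℝ} (hg : Measurable g)
    (hint : IntegrableOn (fun y => acceptDensity σ x y * g y) (Iio 0)) :
    Integrable g (rwmKernelHat σ x) ∧
      ∫ y, g y ∂rwmKernelHat σ x =
        g x + ∫ y in Iio 0, acceptDensity σ x y * (g y - g x) := by
  have hq : Measurable fun y => ENNReal.ofReal (acceptDensity σ x y) :=
    (continuous_acceptDensity_right σ x).measurable.ennreal_ofReal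
  have hqi := (integrable_acceptDensity hσ x).integrableOn (s := Iio 0)
  have htr : ∀ y, (ENNReal.ofReal (acceptDensity σ x y)).toReal = acceptDensity σ x y :=
    fun y => ENNReal.toReal_ofReal (acceptDensity_nonneg hσ x y)
  have hfin : ∀ᵐ y ∂volume.restrict (Iio (0 : ℝ)),
      ENNReal.ofReal (acceptDensity σ x y) < ⊤ := ae_of_all _ fun y => ENNReal.ofReal_lt_top
  have i1 : Integrable g ((volume.restrict (Iio 0)).withDensity
      fun y => ENNReal.ofReal (acceptDensity σ x y)) := by
    rw [integrable_withDensity_iff_integrable_smul' hq hfin]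
    simpa [htr, IntegrableOn] using hint
  have i2 : Integrable g (holdMass σ x • Measure.dirac x) :=
    (integrable_dirac' hg.stronglyMeasurable (by simp)).smul_measure
      (ne_top_of_le_ne_top ENNReal.one_ne_top tsub_le_self)
  have hm : (holdMass σ x).toReal = 1 - ∫ y in Iio 0, acceptDensity σ x y := by
    rw [holdMass, ENNReal.toReal_sub_of_le (lintegral_acceptDensity_le hσ x) ENNReal.one_ne_top,
      integral_eq_lintegral_of_nonneg_ae (ae_of_all _ (acceptDensity_nonneg hσ x))
        hqi.aestronglyMeasurable]
    simp
  rw [rwmKernelHat_eq hσ]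
  refine ⟨i1.add_measure i2, ?_⟩
  rw [integral_add_measure i1 i2, integral_smul_measure,
    integral_dirac' _ _ hg.stronglyMeasurable,
    integral_withDensity_eq_integral_toReal_smul hq hfin, hm]
  simp only [htr, smul_eq_mul, mul_sub]
  rw [integral_sub hint (hqi.mul_const _), integral_mul_const]
  ring

theorem integrableOn_acceptDensity_mul_lyapunov {σ : ℝ} (hσ : 0 < σ) (x : ℝ) :
    IntegrableOn (fun y => acceptDensity σ x y * lyapunov σ y) (Iio 0) := by
  refine Integrable.mono'
    (((integrable_gaussDensity σ).comp_sub_right x).const_mul (4 * lyapunov σ x)).integrableOn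
    ((continuous_acceptDensity_right σ x).mul (continuous_lyapunov σ)).aestronglyMeasurable ?_
  filter_upwards [ae_restrict_mem measurableSet_Iio] with y hy
  rw [Real.norm_of_nonneg (mul_nonneg (acceptDensity_nonneg hσ x y) (lyapunov_pos σ y).le)]
  exact lyapunov_mul_acceptDensity_le hσ hy

theorem setIntegral_gaussDensity_le {σ : ℝ} (hσ : 0 < σ) (x : ℝ) (s : Set ℝ) :
    ∫ y in s, gaussDensity σ (y - x) ≤ 1 := by
  rw [← integral_gaussDensity hσ, ← integral_sub_right_eq_self (gaussDensity σ) x]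
  exact setIntegral_le_integral ((integrable_gaussDensity σ).comp_sub_right x)
    (ae_of_all _ fun y => (gaussDensity_pos hσ _).le)

/-- From far away, with probability bounded below a proposal moves towards the mode. -/
theorem exists_inward_interval {σ x : ℝ} (hσ : 0 < σ) (hx : x < 0) (ha : 2 ≤ |x + 1| / σ) :
    ∃ p : ℝ, (∀ y ∈ Ioo p (p + σ), y < 0 ∧ |y - x| ≤ 2 * σ ∧
      |y + 1| / σ ≤ |x + 1| / σ - 1) := by
  rw [le_div_iff₀ hσ] at ha
  rcases le_total 0 (x + 1) with h | h
  · rw [abs_of_nonneg h] at ha ⊢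
    refine ⟨x - 2 * σ, fun y hy => ?_⟩
    obtain ⟨h1, h2⟩ := hy
    refine ⟨by linarith, abs_le.2 ⟨by linarith, by linarith⟩, ?_⟩
    rw [div_le_iff₀ hσ, sub_mul, div_mul_cancel₀ _ hσ.ne', abs_of_nonneg (by linarith)]
    linarith
  · rw [abs_of_nonpos h] at ha ⊢
    refine ⟨x + σ, fun y hy => ?_⟩
    obtain ⟨h1, h2⟩ := hy
    refine ⟨by linarith, abs_le.2 ⟨by linarith, by linarith⟩, ?_⟩
    rw [div_le_iff₀ hσ, sub_mul, div_mul_cancel₀ _ hσ.ne', abs_of_nonpos (by linarith)]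
    linarith

theorem exp_neg_two_ge : 1 / 9 ≤ Real.exp (-(2 : ℝ) ^ 2 / 2) := by
  have h : Real.exp (-(2 : ℝ) ^ 2 / 2) = 1 / (Real.exp 1 * Real.exp 1) := by
    rw [← Real.exp_add, one_div, ← Real.exp_neg]; norm_num
  rw [h]
  refine one_div_le_one_div_of_le (by positivity) ?_
  nlinarith [exp_one_lt_three, Real.exp_pos 1]

theorem drift_far {σ x : ℝ} (hσ : 0 < σ) (hx : x < 0) (ha : 433 ≤ |x + 1| / σ) :
    ∫ y in Iio 0, acceptDensity σ x y * (lyapunov σ y - lyapunov σ x) ≤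
      -(1 / 216) * lyapunov σ x := by
  obtain ⟨p, hp⟩ := exists_inward_interval hσ hx (by linarith)
  set J := Ioo p (p + σ) with hJ
  have hJ0 : J ⊆ Iio 0 := fun y hy => (hp y hy).1
  have hV := lyapunov_pos σ x
  have hgi := (integrable_gaussDensity σ).comp_sub_right x
  have hbound : ∀ y ∈ Iio (0 : ℝ), acceptDensity σ x y * (lyapunov σ y - lyapunov σ x) ≤
      lyapunov σ x * (1 / 216) * gaussDensity σ (y - x) -
        lyapunov σ x * (1 / 4) * J.indicator (fun y => gaussDensity σ (y - x)) y := by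
    intro y hy
    have hg := gaussDensity_pos hσ (y - x)
    by_cases hyJ : y ∈ J
    · have hb := (hp y hyJ).2.2
      have hr : 1 / 2 ≤ min 1 (mixDensity σ y / mixDensity σ x) := by
        refine le_min (by norm_num) (half_le_mixDensity_ratio hσ hx ?_)
        have : |y + 1| / σ ≤ |x + 1| / σ := by linarith
        exact (div_le_div_iff_of_pos_right hσ).1 this
      have := mul_le_mul_of_nonneg_right (mul_exp_sub_exp_le_neg hb hr) hg.le
      rw [indicator_of_mem hyJ]
      have h0 : 0 ≤ lyapunov σ x * (1 / 216) * gaussDensity σ (y - x) := by positivity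
      unfold acceptDensity
      unfold lyapunov at h0 ⊢
      linarith
    · have h1 := mul_exp_sub_exp_le (a := |x + 1| / σ) (b := |y + 1| / σ) (by linarith)
        (le_min zero_le_one (div_pos (mixDensity_pos hσ y) (mixDensity_pos hσ x)).le)
        ((min_le_right _ _).trans (mixDensity_ratio_le hσ hy))
      have h2 : 2 / (|x + 1| / σ - 1) ≤ 1 / 216 := by
        rw [div_le_div_iff₀ (by linarith) (by norm_num)]; linarith
      have h3 := mul_le_mul_of_nonneg_right
        (h1.trans (mul_le_mul_of_nonneg_right h2 (Real.exp_pos _).le)) hg.le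
      rw [indicator_of_notMem hyJ]
      unfold acceptDensity lyapunov
      linarith
  have hli : IntegrableOn (fun y => acceptDensity σ x y * (lyapunov σ y - lyapunov σ x))
      (Iio 0) := by
    simp only [mul_sub]
    exact (integrableOn_acceptDensity_mul_lyapunov hσ x).sub
      ((integrable_acceptDensity hσ x).integrableOn.mul_const _)
  have hJi : Integrable (J.indicator fun y => gaussDensity σ (y - x)) :=
    hgi.indicator measurableSet_Ioo
  have hmono := setIntegral_mono_on hli
    ((hgi.const_mul (lyapunov σ x * (1 / 216))).integrableOn.sub
      (hJi.const_mul (lyapunov σ x * (1 / 4))).integrableOn) measurableSet_Iio hbound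
  refine hmono.trans ?_
  simp only [Pi.sub_apply]
  rw [integral_sub (hgi.const_mul _).integrableOn (hJi.const_mul _).integrableOn,
    integral_const_mul, integral_const_mul, setIntegral_indicator measurableSet_Ioo,
    inter_eq_self_of_subset_right hJ0]
  have h1 := setIntegral_gaussDensity_le hσ x (Iio 0)
  have h2 : 1 / 27 ≤ ∫ y in J, gaussDensity σ (y - x) := by
    have h3 : ∫ _ in J, 1 / 9 / (3 * σ) ≤ ∫ y in J, gaussDensity σ (y - x) := by
      refine setIntegral_mono_on (integrableOn_const (by simp [hJ])) hgi.integrableOn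
        measurableSet_Ioo fun y hy => ?_
      refine le_trans ?_ (exp_div_le_gaussDensity hσ (hp y hy).2.1)
      have := exp_neg_two_ge
      gcongr
    refine le_trans (le_of_eq ?_) h3
    rw [setIntegral_const, hJ, Measure.real, Real.volume_Ioo, smul_eq_mul,
      ENNReal.toReal_ofReal (by linarith)]
    field_simp; ring
  nlinarith

theorem drift_near {σ x : ℝ} (hσ : 0 < σ) :
    ∫ y in Iio 0, acceptDensity σ x y * (lyapunov σ y - lyapunov σ x) ≤
      4 * lyapunov σ x := by
  have hgi := ((integrable_gaussDensity σ).comp_sub_right x).const_mul (4 * lyapunov σ x)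
  have hV := lyapunov_pos σ x
  have hli : IntegrableOn (fun y => acceptDensity σ x y * (lyapunov σ y - lyapunov σ x))
      (Iio 0) := by
    simp only [mul_sub]
    exact (integrableOn_acceptDensity_mul_lyapunov hσ x).sub
      ((integrable_acceptDensity hσ x).integrableOn.mul_const _)
  refine (setIntegral_mono_on hli hgi.integrableOn measurableSet_Iio fun y hy => ?_).trans ?_
  · rw [mul_sub]
    linarith [lyapunov_mul_acceptDensity_le (x := x) hσ hy,
      mul_nonneg (acceptDensity_nonneg hσ x y) hV.le]
  · rw [integral_const_mul]
    nlinarith [setIntegral_gaussDensity_le hσ x (Iio 0)]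

theorem minor_le {σ ℓ x : ℝ} (hσ : 0 < σ) (hx : x < 0)
    (h : |x + 1| / σ ≤ ℓ) :
    ENNReal.ofReal (Real.exp (-((ℓ + 1) ^ 2) / 2) / 12 / σ) •
      volume.restrict (Ioo (-1 - σ) (-1)) ≤ rwmKernelHat σ x := by
  rw [div_le_iff₀ hσ] at h
  refine Measure.le_iff.2 fun B hB => ?_
  rw [rwmKernelHat_apply hσ x hB, Measure.smul_apply, Measure.restrict_apply hB, smul_eq_mul,
    ← setLIntegral_const]
  refine le_add_of_le_of_nonneg ?_ zero_le
  have hsub : B ∩ Ioo (-1 - σ) (-1) ⊆ B ∩ Iio 0 :=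
    inter_subset_inter_right _ fun y hy => by
      have := hy.2
      simp only [mem_Iio]; linarith
  refine le_trans ?_ (lintegral_mono_set hsub)
  refine setLIntegral_mono' (hB.inter measurableSet_Ioo) fun y hy => ENNReal.ofReal_le_ofReal ?_
  obtain ⟨h1, h2⟩ := hy.2
  have hg : Real.exp (-((ℓ + 1) ^ 2) / 2) / (3 * σ) ≤ gaussDensity σ (y - x) := by
    refine exp_div_le_gaussDensity hσ ?_
    have := abs_le.1 h
    exact abs_le.2 ⟨by linarith, by linarith⟩
  have hr : 1 / 4 ≤ min 1 (mixDensity σ y / mixDensity σ x) := by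
    refine le_min (by norm_num) ?_
    rw [le_div_iff₀ (mixDensity_pos hσ x)]
    have e1 := mixDensity_le σ hx.le
    have e2 : gaussDensity σ (x + 1) ≤ gaussDensity σ 0 := gaussDensity_le_of_abs_le σ (by simp)
    have e3 := le_mixDensity hσ y
    have e4 : gaussDensity σ 0 * (1 / 2) ≤ gaussDensity σ (y + 1) := by
      rw [gaussDensity_eq_mul_exp σ 0 (y + 1)]
      refine mul_le_mul_of_nonneg_left ?_ (gaussDensity_pos hσ 0).le
      have e5 : Real.exp (-(1 / 2)) ≤
          Real.exp (((|0| / σ) ^ 2 - (|y + 1| / σ) ^ 2) / 2) := by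
        refine Real.exp_le_exp.2 ?_
        have e6 : |y + 1| / σ ≤ 1 := by
          rw [div_le_one hσ]; exact abs_le.2 ⟨by linarith, by linarith⟩
        have e7 : (|y + 1| / σ) ^ 2 ≤ 1 := pow_le_one₀ (by positivity) e6
        simp only [abs_zero, zero_div]
        linarith
      refine le_trans ?_ e5
      rw [Real.exp_neg, ← one_div]
      exact one_div_le_one_div_of_le (Real.exp_pos _) exp_half_le_two
    linarith
  calc Real.exp (-((ℓ + 1) ^ 2) / 2) / 12 / σ
      = 1 / 4 * (Real.exp (-((ℓ + 1) ^ 2) / 2) / (3 * σ)) := by field_simp; ring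
    _ ≤ acceptDensity σ x y := by
      unfold acceptDensity
      exact mul_le_mul hr hg (by positivity) (le_trans (by norm_num) hr)

theorem exists_isHarris : ∃ K ε : ℝ, 0 < K ∧ 0 < ε ∧ ε < 1 ∧ ∀ σ : ℝ, ∀ hσ : 0 < σ,
    IsHarris (hatKernel hσ) (Iio 0) (lyapunov σ) (215 / 216) K ε := by
  set K := 5 * Real.exp 433 with hK
  set R := 4 * K / (1 - 215 / 216 : ℝ) with hR
  have hR1 : 1 ≤ R := by
    have := Real.one_le_exp (show (0 : ℝ) ≤ 433 by norm_num)
    rw [hR, hK, le_div_iff₀ (by norm_num)]; linarith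
  have hℓ : 0 ≤ Real.log R := Real.log_nonneg hR1
  refine ⟨K, Real.exp (-((Real.log R + 1) ^ 2) / 2) / 12, by positivity, by positivity, ?_,
    fun σ hσ => ⟨?_, fun x => (lyapunov_pos σ x).le, ?_, ?_, ?_⟩⟩
  · have : Real.exp (-((Real.log R + 1) ^ 2) / 2) ≤ 1 :=
      Real.exp_le_one_iff.2 (by nlinarith [sq_nonneg (Real.log R + 1)])
    linarith
  · intro x hx
    rw [ae_iff]
    have hB : MeasurableSet (Ici (0 : ℝ)) := measurableSet_Ici
    have : {a : ℝ | a ∉ Iio 0} = Ici 0 := by ext; simp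
    rw [this]
    change rwmKernelHat σ x (Ici 0) = 0
    have hx' : x ∉ Ici (0 : ℝ) := by simpa using hx
    rw [rwmKernelHat_apply hσ x hB, indicator_of_notMem hx', Ici_inter_Iio]
    simp
  · intro x _
    exact (integral_rwmKernelHat hσ x (continuous_lyapunov σ).measurable
      (integrableOn_acceptDensity_mul_lyapunov hσ x)).1
  · intro x hx
    change ∫ y, lyapunov σ y ∂rwmKernelHat σ x ≤ _
    rw [(integral_rwmKernelHat hσ x (continuous_lyapunov σ).measurable
      (integrableOn_acceptDensity_mul_lyapunov hσ x)).2]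
    rcases le_total 433 (|x + 1| / σ) with h | h
    · have hK0 : 0 < K := by positivity
      linarith [drift_far hσ hx h]
    · have h1 := drift_near (x := x) hσ
      have h2 : lyapunov σ x ≤ Real.exp 433 := Real.exp_le_exp.2 h
      have h3 := lyapunov_pos σ x
      linarith
  · refine ⟨_, ?_, fun x hx hVx => minor_le (ℓ := Real.log R) hσ hx ?_⟩
    · rw [Measure.real, Measure.smul_apply, Measure.restrict_apply_univ, Real.volume_Ioo,
        smul_eq_mul, ENNReal.toReal_mul, ENNReal.toReal_ofReal (by positivity),
        ENNReal.toReal_ofReal (by linarith)]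
      field_simp; ring
    · rw [Real.le_log_iff_exp_le (by linarith)]
      exact hVx

end Estimates

section HalfLine

theorem integrable_mixDensity (σ : ℝ) : Integrable (mixDensity σ) :=
  (((integrable_gaussDensity σ).comp_add_right 1).const_mul (1 / 2)).add
    (((integrable_gaussDensity σ).comp_sub_right 1).const_mul (1 / 2))

theorem integral_mixDensity {σ : ℝ} (hσ : 0 < σ) : ∫ x, mixDensity σ x = 1 := by
  unfold mixDensity
  rw [integral_add (((integrable_gaussDensity σ).comp_add_right 1).const_mul (1 / 2))
    (((integrable_gaussDensity σ).comp_sub_right 1).const_mul (1 / 2)), integral_const_mul,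
    integral_const_mul, integral_add_right_eq_self, integral_sub_right_eq_self,
    integral_gaussDensity hσ]
  norm_num

theorem mixDensity_neg (σ x : ℝ) : mixDensity σ (-x) = mixDensity σ x := by
  simp only [mixDensity, gaussDensity]
  ring_nf

theorem setIntegral_Iio_mixDensity {σ : ℝ} (hσ : 0 < σ) :
    ∫ x in Iio 0, mixDensity σ x = 1 / 2 := by
  have hi := integrable_mixDensity σ
  have h1 := integral_comp_neg_Ioi 0 (mixDensity σ)
  simp only [mixDensity_neg, neg_zero] at h1
  have h2 := integral_add_compl (measurableSet_Iic (a := (0 : ℝ))) hi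
  rw [compl_Iic, integral_mixDensity hσ, h1] at h2
  rw [← integral_Iic_eq_integral_Iio]
  linarith

theorem isProbabilityMeasure_piHalf {σ : ℝ} (hσ : 0 < σ) : IsProbabilityMeasure (piHalf σ) := by
  constructor
  rw [piHalf, withDensity_apply _ MeasurableSet.univ, Measure.restrict_univ,
    ← ofReal_integral_eq_lintegral_ofReal
      ((integrable_mixDensity σ).integrableOn.const_mul 2)
      (ae_of_all _ fun x => by have := mixDensity_pos hσ x; simp only [Pi.zero_apply]; linarith),
    integral_const_mul, setIntegral_Iio_mixDensity hσ]
  norm_num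

theorem ae_piHalf_mem_Iio (σ : ℝ) : ∀ᵐ y ∂piHalf σ, y ∈ Iio (0 : ℝ) :=
  (withDensity_absolutelyContinuous _ _).ae_le (ae_restrict_mem measurableSet_Iio)

theorem exp_abs_div_mul_gaussDensity_le {σ : ℝ} (hσ : 0 < σ) (t : ℝ) :
    Real.exp (|t| / σ) * gaussDensity σ t ≤ 6 * gaussDensity (2 * σ) t := by
  have h1 : Real.sqrt (2 * Real.pi * (2 * σ) ^ 2) = 2 * Real.sqrt (2 * Real.pi * σ ^ 2) := by
    rw [show 2 * Real.pi * (2 * σ) ^ 2 = 2 ^ 2 * (2 * Real.pi * σ ^ 2) by ring,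
      Real.sqrt_mul (by norm_num), Real.sqrt_sq (by norm_num)]
  have h2 : Real.exp (|t| / σ) * Real.exp (-(t ^ 2) / (2 * σ ^ 2)) ≤
      3 * Real.exp (-(t ^ 2) / (2 * (2 * σ) ^ 2)) := by
    calc Real.exp (|t| / σ) * Real.exp (-(t ^ 2) / (2 * σ ^ 2))
        ≤ Real.exp (1 + -(t ^ 2) / (2 * (2 * σ) ^ 2)) := by
          rw [← Real.exp_add]
          refine Real.exp_le_exp.2 ?_
          have e1 : -(t ^ 2) / (2 * σ ^ 2) = -(|t| / σ) ^ 2 / 2 := by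
            rw [div_pow, sq_abs]; field_simp
          have e2 : -(t ^ 2) / (2 * (2 * σ) ^ 2) = -(|t| / σ) ^ 2 / 8 := by
            rw [div_pow, sq_abs]; field_simp; ring
          rw [e1, e2]
          nlinarith [sq_nonneg (|t| / σ - 4 / 3)]
      _ ≤ 3 * Real.exp (-(t ^ 2) / (2 * (2 * σ) ^ 2)) := by
        rw [Real.exp_add]
        gcongr
        exact exp_one_lt_three.le
  have h3 : 0 ≤ (Real.sqrt (2 * Real.pi * σ ^ 2))⁻¹ := by positivity
  have h4 := mul_le_mul_of_nonneg_left h2 h3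
  rw [gaussDensity, gaussDensity, h1, mul_inv]
  linarith

theorem integral_lyapunov_piHalf {σ : ℝ} (hσ : 0 < σ) :
    Integrable (lyapunov σ) (piHalf σ) ∧ ∫ y, lyapunov σ y ∂piHalf σ ≤ 12 := by
  have hm : Measurable fun x => ENNReal.ofReal (2 * mixDensity σ x) :=
    ((continuous_mixDensity σ).measurable.const_mul 2).ennreal_ofReal
  have h0 : ∀ x, 0 ≤ 2 * mixDensity σ x := fun x => by linarith [mixDensity_pos hσ x]
  have htr : ∀ x, (ENNReal.ofReal (2 * mixDensity σ x)).toReal = 2 * mixDensity σ x :=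
    fun x => ENNReal.toReal_ofReal (h0 x)
  have hfin : ∀ᵐ y ∂volume.restrict (Iio (0 : ℝ)),
      ENNReal.ofReal (2 * mixDensity σ y) < ⊤ := ae_of_all _ fun y => ENNReal.ofReal_lt_top
  have hgi := ((integrable_gaussDensity (2 * σ)).comp_add_right 1).const_mul 12
  have hle : ∀ y ∈ Iio (0 : ℝ), 2 * mixDensity σ y * lyapunov σ y ≤
      12 * gaussDensity (2 * σ) (y + 1) := by
    intro y hy
    have h1 := mul_le_mul_of_nonneg_right (mixDensity_le σ (le_of_lt hy)) (lyapunov_pos σ y).le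
    have h2 := exp_abs_div_mul_gaussDensity_le hσ (y + 1)
    unfold lyapunov at h1 ⊢
    linarith
  have hint : IntegrableOn (fun y => 2 * mixDensity σ y * lyapunov σ y) (Iio 0) := by
    refine hgi.integrableOn.mono' (((continuous_mixDensity σ).const_mul 2).mul
      (continuous_lyapunov σ)).aestronglyMeasurable ?_
    filter_upwards [ae_restrict_mem measurableSet_Iio] with y hy
    rw [Real.norm_of_nonneg (mul_nonneg (h0 y) (lyapunov_pos σ y).le)]
    exact hle y hy
  constructor
  · rw [piHalf, integrable_withDensity_iff_integrable_smul' hm hfin]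
    simp only [htr, smul_eq_mul]
    exact hint
  · rw [piHalf, integral_withDensity_eq_integral_toReal_smul hm hfin]
    simp only [htr, smul_eq_mul]
    refine (setIntegral_mono_on hint hgi.integrableOn measurableSet_Iio hle).trans ?_
    refine (setIntegral_le_integral hgi (ae_of_all _ fun y =>
      mul_nonneg (by norm_num) (gaussDensity_pos (by linarith) _).le)).trans ?_
    rw [integral_const_mul, integral_add_right_eq_self (gaussDensity (2 * σ)),
      integral_gaussDensity (by linarith), mul_one]

theorem rwmProb_Ici {σ x : ℝ} (hx : x < 0) :
    rwmProb σ x (Ici 0) = ∫ y in Ici 0, acceptDensity σ x y := by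
  have hx' : x ∉ Ici (0 : ℝ) := by simpa using hx
  rw [rwmProb, indicator_of_notMem hx', zero_mul, add_zero, ← integral_indicator measurableSet_Ici,
    ← integral_add_left_eq_self ((Ici 0).indicator _) x]
  congr 1; ext z
  by_cases hz : x + z ∈ Ici (0 : ℝ)
  · rw [indicator_of_mem hz, indicator_of_mem hz, acceptDensity, add_sub_cancel_left, one_mul]
  · rw [indicator_of_notMem hz, indicator_of_notMem hz, zero_mul, zero_mul]

theorem integrable_crossing {σ : ℝ} (hσ : 0 < σ) :
    Integrable fun x => (∫ y in Ici 0, acceptDensity σ x y) * mixDensity σ x := by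
  have hsm : StronglyMeasurable fun x => ∫ y in Ici (0 : ℝ), acceptDensity σ x y :=
    (continuous_acceptDensity hσ).stronglyMeasurable.integral_prod_right
  refine (integrable_mixDensity σ).mono'
    (hsm.aestronglyMeasurable.mul (continuous_mixDensity σ).aestronglyMeasurable)
    (ae_of_all _ fun x => ?_)
  have h0 : 0 ≤ ∫ y in Ici (0 : ℝ), acceptDensity σ x y :=
    integral_nonneg fun y => acceptDensity_nonneg hσ x y
  have h1 : ∫ y in Ici (0 : ℝ), acceptDensity σ x y ≤ 1 :=
    (setIntegral_le_integral (integrable_acceptDensity hσ x)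
      (ae_of_all _ (acceptDensity_nonneg hσ x))).trans (integral_acceptDensity_le hσ x)
  have h2 := mixDensity_pos hσ x
  rw [Real.norm_of_nonneg (mul_nonneg h0 h2.le)]
  exact mul_le_of_le_one_left h2.le h1

theorem exp_le_mixDensity {σ y : ℝ} (hσ : 0 < σ) (hy : |y| ≤ 1) :
    Real.exp (-((1 / σ) ^ 2) / 2) / (6 * σ) ≤ mixDensity σ y := by
  have h1 : 1 ≤ 1 / σ * σ := by rw [one_div_mul_cancel hσ.ne']
  have key : ∀ z : ℝ, |z| ≤ 1 →
      1 / 2 * (Real.exp (-((1 / σ) ^ 2) / 2) / (3 * σ)) ≤ 1 / 2 * gaussDensity σ z :=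
    fun z hz => mul_le_mul_of_nonneg_left (exp_div_le_gaussDensity hσ (hz.trans h1)) (by norm_num)
  have h2 : Real.exp (-((1 / σ) ^ 2) / 2) / (6 * σ) =
      1 / 2 * (Real.exp (-((1 / σ) ^ 2) / 2) / (3 * σ)) := by field_simp; norm_num
  obtain ⟨h3, h4⟩ := abs_le.1 hy
  rw [h2]
  rcases le_total y 0 with h | h
  · exact (key (y + 1) (abs_le.2 ⟨by linarith, by linarith⟩)).trans (le_mixDensity hσ y)
  · exact (key (y - 1) (abs_le.2 ⟨by linarith, by linarith⟩)).trans (le_mixDensity' hσ y)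

theorem exp_le_PhiHalf {σ : ℝ} (hσ : 0 < σ) (hσ1 : σ ≤ 1) :
    Real.exp (-((1 / σ) ^ 2) / 2) / 81 ≤ PhiHalf σ := by
  set E := Real.exp (-((1 / σ) ^ 2) / 2) with hE
  have hE0 : 0 < E := Real.exp_pos _
  have hpt : ∀ x ∈ Ioo (-σ) 0, ∀ y ∈ Ioo 0 σ,
      E / (6 * σ) * (1 / 9 / (3 * σ)) ≤ acceptDensity σ x y * mixDensity σ x := by
    rintro x ⟨hx1, hx2⟩ y ⟨hy1, hy2⟩
    have hg : 1 / 9 / (3 * σ) ≤ gaussDensity σ (y - x) := by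
      refine le_trans ?_ (exp_div_le_gaussDensity hσ
        (abs_le.2 ⟨by linarith, by linarith⟩ : |y - x| ≤ 2 * σ))
      have := exp_neg_two_ge
      gcongr
    have hfx := exp_le_mixDensity (y := x) hσ (abs_le.2 ⟨by linarith, by linarith⟩)
    have hfy := exp_le_mixDensity (y := y) hσ (abs_le.2 ⟨by linarith, by linarith⟩)
    have hp := mixDensity_pos hσ x
    have e : acceptDensity σ x y * mixDensity σ x =
        min (mixDensity σ x) (mixDensity σ y) * gaussDensity σ (y - x) := by
      rw [acceptDensity, mul_comm, ← mul_assoc, mul_min_of_nonneg _ _ hp.le, mul_one,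
        mul_div_cancel₀ _ hp.ne']
    rw [e]
    exact mul_le_mul (le_min hfx hfy) hg (by positivity)
      (le_min hp.le (mixDensity_pos hσ y).le)
  have hx : ∀ x ∈ Ioo (-σ) 0, E / (6 * σ) * (1 / 9 / (3 * σ)) * σ ≤
      (∫ y in Ici 0, acceptDensity σ x y) * mixDensity σ x := by
    intro x hx
    have hi := (integrable_acceptDensity hσ x).mul_const (mixDensity σ x)
    rw [← integral_mul_const]
    calc E / (6 * σ) * (1 / 9 / (3 * σ)) * σ
        = ∫ _ in Ioo 0 σ, E / (6 * σ) * (1 / 9 / (3 * σ)) := by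
          rw [setIntegral_const, Measure.real, Real.volume_Ioo, smul_eq_mul,
            ENNReal.toReal_ofReal (by linarith)]
          ring
      _ ≤ ∫ y in Ioo 0 σ, acceptDensity σ x y * mixDensity σ x :=
        setIntegral_mono_on (integrableOn_const (by simp)) hi.integrableOn measurableSet_Ioo
          (hpt x hx)
      _ ≤ ∫ y in Ici 0, acceptDensity σ x y * mixDensity σ x :=
        setIntegral_mono_set hi.integrableOn (ae_of_all _ fun y =>
          mul_nonneg (acceptDensity_nonneg hσ x y) (mixDensity_pos hσ x).le)
          (LE.le.eventuallyLE fun y hy => hy.1.le)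
  have hi := integrable_crossing hσ
  rw [PhiHalf, setIntegral_congr_fun measurableSet_Iio
    (g := fun x => (∫ y in Ici 0, acceptDensity σ x y) * mixDensity σ x)
    fun x hx => by simp only [rwmProb_Ici hx]]
  have h1 : E / (6 * σ) * (1 / 9 / (3 * σ)) * σ * σ ≤
      ∫ x in Iio 0, (∫ y in Ici 0, acceptDensity σ x y) * mixDensity σ x := by
    calc E / (6 * σ) * (1 / 9 / (3 * σ)) * σ * σ
        = ∫ _ in Ioo (-σ) 0, E / (6 * σ) * (1 / 9 / (3 * σ)) * σ := by
          rw [setIntegral_const, Measure.real, Real.volume_Ioo, smul_eq_mul,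
            ENNReal.toReal_ofReal (by linarith)]
          ring
      _ ≤ ∫ x in Ioo (-σ) 0, (∫ y in Ici 0, acceptDensity σ x y) * mixDensity σ x :=
        setIntegral_mono_on (integrableOn_const (by simp)) hi.integrableOn measurableSet_Ioo hx
      _ ≤ ∫ x in Iio 0, (∫ y in Ici 0, acceptDensity σ x y) * mixDensity σ x :=
        setIntegral_mono_set hi.integrableOn (ae_of_all _ fun x =>
          mul_nonneg (integral_nonneg fun y => acceptDensity_nonneg hσ x y)
            (mixDensity_pos hσ x).le)
          (LE.le.eventuallyLE fun x hx => hx.2)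
  have h2 : E / (6 * σ) * (1 / 9 / (3 * σ)) * σ * σ = E / 162 := by field_simp; norm_num
  linarith

theorem lyapunov_le {σ x : ℝ} (hσ : 0 < σ) (hσ1 : σ ≤ 1) (hx : x ∈ Ioo (-(1 / σ ^ 9)) (0 : ℝ)) :
    lyapunov σ x ≤ Real.exp ((1 / σ) ^ 10) := by
  obtain ⟨h1, h2⟩ := hx
  have h3 : 1 ≤ 1 / σ ^ 9 := by
    rw [le_div_iff₀ (by positivity), one_mul]; exact pow_le_one₀ hσ.le hσ1
  refine Real.exp_le_exp.2 ?_
  rw [div_le_iff₀ hσ]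
  have h4 : (1 / σ) ^ 10 * σ = 1 / σ ^ 9 := by field_simp
  rw [h4]
  exact abs_le.2 ⟨by linarith, by linarith⟩

theorem pow_ceil_le {r s : ℝ} (hr : 0 < r) (hr1 : r < 1) {n : ℕ}
    (hn : 4 / -Real.log r * s ≤ n) : r ^ n ≤ Real.exp (-(4 * s)) := by
  have hlog : 0 < -Real.log r := neg_pos.2 (Real.log_neg hr hr1)
  rw [← Real.exp_log hr, ← Real.exp_nat_mul, Real.exp_le_exp]
  have := mul_le_mul_of_nonneg_right hn hlog.le
  have h2 : 4 / -Real.log r * s * -Real.log r = 4 * s := by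
    rw [mul_right_comm, div_mul_cancel₀ _ hlog.ne']
  linarith

theorem mul_exp_neg_le {s D : ℝ} (hs : 1 ≤ s) (hD : 162 * D ≤ s) :
    Real.exp (-(4 * s ^ 10)) * (D * Real.exp (s ^ 10)) ≤
      (1 / s) ^ 2 * (Real.exp (-(s ^ 2) / 2) / 81) := by
  have hs0 : 0 < s := by linarith
  have e1 : s ^ 2 ≤ s ^ 10 := pow_le_pow_right₀ hs (by norm_num)
  have e2 : s ≤ s ^ 10 := le_self_pow₀ hs (by norm_num)
  have h1 : 81 * D ≤ Real.exp (s ^ 10 / 2) := by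
    linarith [Real.add_one_le_exp (s ^ 10 / 2)]
  have h2 : s ^ 2 ≤ Real.exp (s ^ 10) := by linarith [Real.add_one_le_exp (s ^ 10)]
  have h3 : 81 * D * s ^ 2 ≤ Real.exp (5 / 2 * s ^ 10) * Real.exp (-(s ^ 2) / 2) := by
    calc 81 * D * s ^ 2 ≤ Real.exp (s ^ 10 / 2) * Real.exp (s ^ 10) :=
          mul_le_mul h1 h2 (by positivity) (Real.exp_pos _).le
      _ ≤ Real.exp (5 / 2 * s ^ 10) * Real.exp (-(s ^ 2) / 2) := by
        rw [← Real.exp_add, ← Real.exp_add]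
        exact Real.exp_le_exp.2 (by linarith)
  have h4 : Real.exp (-(4 * s ^ 10)) * Real.exp (s ^ 10) * Real.exp (5 / 2 * s ^ 10) ≤ 1 := by
    rw [← Real.exp_add, ← Real.exp_add]
    exact Real.exp_le_one_iff.2 (by nlinarith)
  have h5 := mul_le_mul_of_nonneg_left h3
    (show 0 ≤ Real.exp (-(4 * s ^ 10)) * Real.exp (s ^ 10) by positivity)
  have h6 := mul_le_mul_of_nonneg_right h4 (Real.exp_pos (-(s ^ 2) / 2)).le
  rw [one_div, inv_pow, inv_mul_eq_div, div_div, le_div_iff₀ (by positivity)]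
  linarith

end HalfLine

/-- Rapid mixing within the left mode: after `T = ⌈A σ^{-c}⌉` steps of `K̂_σ` from any
`x ∈ (-σ^{-9},0)`, the law is within `σ² Φ_σ` of `π_σ|_{(-∞,0)}` in total variation. -/
theorem stmt19 :
    ∃ A c : ℝ, 0 < A ∧ 0 < c ∧ ∃ σ₀ : ℝ, 0 < σ₀ ∧
      ∀ σ : ℝ, 0 < σ → σ < σ₀ →
        ∀ x ∈ Set.Ioo (-(1 / σ ^ 9)) (0 : ℝ),
          ∀ B : Set ℝ, MeasurableSet B →
            |(kiter (rwmKernelHat σ) ⌈A * σ ^ (-c)⌉₊ x B).toReal - (piHalf σ B).toReal|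
              ≤ σ ^ 2 * PhiHalf σ := by
  obtain ⟨K, ε, hK, hε, hε1, hH⟩ := exists_isHarris
  set r := harrisRate (215 / 216) ε with hr
  have hr0 : 0 < r := lt_of_lt_of_le (by norm_num) (le_max_right _ _)
  have hr1 : r < 1 := max_lt (by linarith) (by norm_num)
  have hlog : 0 < -Real.log r := neg_pos.2 (Real.log_neg hr0 hr1)
  set D := 2 + ε / (2 * K) * 13 with hD
  have hD2 : 2 ≤ D := le_add_of_nonneg_right (by positivity)
  refine ⟨4 / -Real.log r, 10, by positivity, by norm_num, 1 / (162 * D), by positivity,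
    fun σ hσ hσ0 x hx B hB => ?_⟩
  have hs : 162 * D ≤ 1 / σ := by
    rw [le_div_iff₀ hσ, ← le_div_iff₀' (by positivity)]; exact hσ0.le
  have hs1 : 1 ≤ 1 / σ := by linarith
  have hσ1 : σ ≤ 1 := by rwa [le_div_iff₀ hσ, one_mul] at hs1
  have hpow : σ ^ (-10 : ℝ) = (1 / σ) ^ 10 := by
    rw [Real.rpow_neg hσ.le, one_div, inv_pow]
    norm_cast
  have := isProbabilityMeasure_piHalf hσ
  obtain ⟨hVi, hV⟩ := integral_lyapunov_piHalf hσ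
  have hmix := (hH σ hσ).abs_kiter_sub_le (by norm_num) (by norm_num) hK hε hε1
    (piHalf_bind hσ) (ae_piHalf_mem_Iio σ) hVi ⌈4 / -Real.log r * σ ^ (-10 : ℝ)⌉₊ hB hx.2
  have hrate : r ^ ⌈4 / -Real.log r * σ ^ (-10 : ℝ)⌉₊ ≤ Real.exp (-(4 * (1 / σ) ^ 10)) :=
    pow_ceil_le hr0 hr1 (hpow ▸ Nat.le_ceil _)
  have hweight : 2 + ε / (2 * K) * (lyapunov σ x + ∫ y, lyapunov σ y ∂piHalf σ) ≤
      D * Real.exp ((1 / σ) ^ 10) := by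
    have h1 := lyapunov_le hσ hσ1 hx
    have h2 : 1 ≤ Real.exp ((1 / σ) ^ 10) := Real.one_le_exp (by positivity)
    have h3 : lyapunov σ x + ∫ y, lyapunov σ y ∂piHalf σ ≤ 13 * Real.exp ((1 / σ) ^ 10) := by
      linarith
    have h4 := mul_le_mul_of_nonneg_left h3 (show 0 ≤ ε / (2 * K) by positivity)
    rw [hD]
    linarith
  calc _ ≤ _ := hmix
    _ ≤ Real.exp (-(4 * (1 / σ) ^ 10)) *
        (2 + ε / (2 * K) * (lyapunov σ x + ∫ y, lyapunov σ y ∂piHalf σ)) := by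
      refine mul_le_mul_of_nonneg_right hrate ?_
      have h5 : 0 ≤ ∫ y, lyapunov σ y ∂piHalf σ := integral_nonneg fun y => (lyapunov_pos σ y).le
      have h6 := lyapunov_pos σ x
      positivity
    _ ≤ Real.exp (-(4 * (1 / σ) ^ 10)) * (D * Real.exp ((1 / σ) ^ 10)) :=
      mul_le_mul_of_nonneg_left hweight (Real.exp_pos _).le
    _ ≤ (1 / (1 / σ)) ^ 2 * (Real.exp (-((1 / σ) ^ 2) / 2) / 81) := mul_exp_neg_le hs1 hs
    _ ≤ σ ^ 2 * PhiHalf σ := by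
      rw [one_div_one_div]
      exact mul_le_mul_of_nonneg_left (exp_le_PhiHalf hσ hσ1) (sq_nonneg σ)
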